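/- For containers with decidable equality on shapes, the finite-powerset construction yields a monad T on containers together with a right T-comodule on ⟨⟨-⟩⟩ given by restriction: define T(A ◁ P) := (Finset A) ◁ (fun S => ∀ a ∈ S, P a), with unit η_{A◁P} given by shape map a ↦ {a} and position map (fun u => u a (mem of a in {a})), and with Kleisli extension of (f, g) : (A ◁ P) → T(B ◁ Q) given on shapes by S ↦ S.biUnion f and on positions by sending u : ∀ b ∈ S.biUnion f, Q b to the function a ↦ g a (restriction of u to f a) for a ∈ S. Then: (i) the three Kleisli-triple monad laws hold; and (ii) the family of restriction maps c_{A◁P} : (∀ a : A, P a) → (∀ S : Finset A, ∀ a ∈ S, P a), c h S = fun a _ => h a, is natural in A ◁ P and satisfies the right T-comodule laws ⟨⟨η_{A◁P}⟩⟩ ∘ c_{A◁P} = id and c_{T(A◁P)} ∘ c_{A◁P} = ⟨⟨μ_{A◁P}⟩⟩ ∘ c_{A◁P}, where μ_{A◁P} = (id_{T(A◁P)})†. -/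

import Mathlib

/-- A container whose type of shapes has decidable equality. -/
structure DCtnr : Type 1 where
  A : Type
  deq : DecidableEq A
  P : A → Type

attribute [instance] DCtnr.deq

/-- A container morphism: a shape map together with a contravariant position map. -/
structure DCtnrHom (X Y : DCtnr) : Type where
  shape : X.A → Y.A
  pos : ∀ a : X.A, Y.P (shape a) → X.P a

/-- The identity container morphism. -/
def DCtnrHom.id (X : DCtnr) : DCtnrHom X X :=
  ⟨fun a => a, fun _ p => p⟩

/-- Composition of container morphisms. -/
def DCtnrHom.comp {X Y Z : DCtnr} (g : DCtnrHom Y Z) (f : DCtnrHom X Y) : DCtnrHom X Z :=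
  ⟨fun a => g.shape (f.shape a), fun a r => f.pos a (g.pos (f.shape a) r)⟩

/-- The cointerpretation of a container (at the unit type). -/
def cosem (X : DCtnr) : Type := ∀ a : X.A, X.P a

/-- The contravariant action of the cointerpretation on container morphisms. -/
def cosemMap {X Y : DCtnr} (h : DCtnrHom X Y) : cosem Y → cosem X :=
  fun α a => h.pos a (α (h.shape a))

/-- The object part of the finite-powerset monad on containers:
shapes are finite subsets, positions are restricted dependent products. -/
def TFin (X : DCtnr) : DCtnr where
  A := Finset X.A
  deq := inferInstance
  P := fun S => ∀ a ∈ S, X.P a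

/-- The unit of the finite-powerset monad on containers. -/
def etaFin (X : DCtnr) : DCtnrHom X (TFin X) where
  shape a := ({a} : Finset X.A)
  pos a u := u a (Finset.mem_singleton_self a)

/-- The Kleisli extension of the finite-powerset monad on containers. -/
def bindFin {X Y : DCtnr} (h : DCtnrHom X (TFin Y)) : DCtnrHom (TFin X) (TFin Y) where
  shape S := S.biUnion h.shape
  pos S u a ha := h.pos a (fun b hb => u b (Finset.mem_biUnion.mpr ⟨a, ha, hb⟩))

/-- The restriction comodule structure map. -/
def restrict (X : DCtnr) : cosem X → cosem (TFin X) :=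
  fun h _S a _ => h a

/-- Morphisms into a finite-powerset container are equal when their shapes agree and their
position maps agree up to transport of membership proofs. -/
theorem DCtnrHom.ext_of_shape_eq {X Y : DCtnr} {h k : DCtnrHom X (TFin Y)}
    (hs : ∀ a : X.A, h.shape a = k.shape a)
    (hp : ∀ (a : X.A) (u : (TFin Y).P (h.shape a)),
      h.pos a u = k.pos a (fun b hb => u b ((hs a).symm ▸ hb))) : h = k := by
  obtain ⟨f, p⟩ := h
  obtain ⟨g, q⟩ := k
  obtain rfl : f = g := funext hs
  obtain rfl : p = q := funext fun a => funext fun u => hp a u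
  rfl

/-- The finite-powerset construction yields a monad on containers with decidable equality
of shapes, and restriction is a right comodule structure map on the cointerpretation. -/
theorem finite_powerset_monad_and_restriction_comodule :
    -- (i) the three Kleisli-triple monad laws
    ((∀ X : DCtnr, bindFin (etaFin X) = DCtnrHom.id (TFin X)) ∧
     (∀ (X Y : DCtnr) (h : DCtnrHom X (TFin Y)),
       (bindFin h).comp (etaFin X) = h) ∧
     (∀ (X Y Z : DCtnr) (h : DCtnrHom X (TFin Y)) (k : DCtnrHom Y (TFin Z)),
       bindFin ((bindFin k).comp h) = (bindFin k).comp (bindFin h))) ∧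
    -- (ii) restriction is natural and satisfies the right comodule laws
    ((∀ (X Y : DCtnr) (h : DCtnrHom X Y) (α : cosem Y),
       restrict X (cosemMap h α) =
         cosemMap (bindFin ((etaFin Y).comp h)) (restrict Y α)) ∧
     (∀ (X : DCtnr) (α : cosem X), cosemMap (etaFin X) (restrict X α) = α) ∧
     (∀ (X : DCtnr) (α : cosem X),
       restrict (TFin X) (restrict X α) =
         cosemMap (bindFin (DCtnrHom.id (TFin X))) (restrict X α))) := by
  refine ⟨⟨fun X => ?_, fun X Y h => ?_, fun X Y Z h k => ?_⟩,
    fun _ _ _ _ => rfl, fun _ _ => rfl, fun _ _ => rfl⟩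
  · exact DCtnrHom.ext_of_shape_eq
      (fun _ => Finset.biUnion_singleton_eq_self) fun _ _ => rfl
  · exact DCtnrHom.ext_of_shape_eq
      (fun _ => Finset.singleton_biUnion) fun _ _ => rfl
  · exact DCtnrHom.ext_of_shape_eq
      (fun S => (Finset.biUnion_biUnion S h.shape k.shape).symm) fun _ _ => rfl
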